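/- Sphere test for norm regularizers: let g be a group and suppose Ω_g = N is a norm on ℝ^{|g|} with dual norm N°(v) = sup_{N(u) ≤ 1} ⟨v, u⟩. Let β̂ ∈ ℝᵖ and θ̂ ∈ ℝⁿ satisfy X_g^⊤ θ̂ ∈ ∂N(β̂_g), and suppose θ̂ ∈ B(c,r) for some c ∈ ℝⁿ, r ≥ 0. If N°(X_g^⊤ c) + r · sup_{‖u‖ ≤ 1} N°(X_g^⊤ u) < 1, then β̂_g = 0. -/

import Mathlib

noncomputable section

/-- The subdifferential of an extended-real-valued function `h` at `x`. -/
def subdiff {m : ℕ} (h : EuclideanSpace ℝ (Fin m) → EReal)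
    (x : EuclideanSpace ℝ (Fin m)) : Set (EuclideanSpace ℝ (Fin m)) :=
  {v | ∀ z, h x + ((inner ℝ v (z - x) : ℝ) : EReal) ≤ h z}

/-- Dual norm of a norm `N` on `ℝ^m`: `N°(v) = sup_{N(u) ≤ 1} ⟨v, u⟩`. -/
def dualNorm {m : ℕ} (N : EuclideanSpace ℝ (Fin m) → ℝ) (v : EuclideanSpace ℝ (Fin m)) : ℝ :=
  sSup ((fun u : EuclideanSpace ℝ (Fin m) => (inner ℝ v u : ℝ)) '' {u | N u ≤ 1})

/-- `X_g^⊤ θ` for the submatrix `X_g ∈ ℝ^{n×m}` and `θ ∈ ℝⁿ`. -/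
def mvT {n m : ℕ} (Xg : Matrix (Fin n) (Fin m) ℝ) (θ : EuclideanSpace ℝ (Fin n)) :
    EuclideanSpace ℝ (Fin m) :=
  WithLp.toLp 2 fun j => ∑ i, Xg i j * θ i

theorem norm_equiv_aux {m : ℕ} (N : EuclideanSpace ℝ (Fin m) → ℝ)
    (hN_add : ∀ x y, N (x + y) ≤ N x + N y)
    (hN_smul : ∀ (a : ℝ) x, N (a • x) = |a| * N x)
    (hN_pos : ∀ x, N x = 0 → x = 0) :
    ∃ C : ℝ, 0 ≤ C ∧ ∀ u, ‖u‖ ≤ C * N u := by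
  have h0 : N 0 = 0 := by simpa using hN_smul 0 0
  have hnn : ∀ x, 0 ≤ N x := by
    intro x
    have h1 := hN_add x ((-1 : ℝ) • x)
    rw [hN_smul] at h1
    simp [h0] at h1
    linarith
  have hconv : ConvexOn ℝ Set.univ N := by
    refine ⟨convex_univ, ?_⟩
    intro x _ y _ a b ha hb _
    have := hN_add (a • x) (b • y)
    rw [hN_smul, hN_smul, abs_of_nonneg ha, abs_of_nonneg hb] at this
    simpa using this
  have hcont : ContinuousOn N Set.univ := hconv.continuousOn isOpen_univ
  rw [continuousOn_univ] at hcont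
  rcases (Metric.sphere (0 : EuclideanSpace ℝ (Fin m)) 1).eq_empty_or_nonempty with he | hne
  · refine ⟨0, le_rfl, fun u => ?_⟩
    by_contra hu
    have hu : 0 < ‖u‖ := by simpa using hu
    have : (‖u‖⁻¹ • u) ∈ Metric.sphere (0 : EuclideanSpace ℝ (Fin m)) 1 := by
      simp [norm_smul, hu.ne']
    rw [he] at this
    exact this
  · obtain ⟨x, hx, hmin⟩ := (isCompact_sphere (0 : EuclideanSpace ℝ (Fin m)) 1).exists_isMinOn
      hne hcont.continuousOn
    have hxN : 0 < N x := by
      refine lt_of_le_of_ne (hnn x) fun h => ?_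
      have := hN_pos x h.symm
      subst this
      simp at hx
    refine ⟨(N x)⁻¹, by positivity, fun u => ?_⟩
    rcases eq_or_ne u 0 with rfl | hu
    · simp [h0]
    have hu : 0 < ‖u‖ := norm_pos_iff.2 hu
    have hm : (‖u‖⁻¹ • u) ∈ Metric.sphere (0 : EuclideanSpace ℝ (Fin m)) 1 := by
      simp [norm_smul, hu.ne']
    have h := hmin hm
    simp only [Set.mem_setOf_eq] at h
    rw [hN_smul, abs_of_pos (by positivity), inv_mul_eq_div, le_div_iff₀ hu] at h
    rw [inv_mul_eq_div, le_div_iff₀ hxN]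
    linarith

theorem dual_bound_aux {m : ℕ} (N : EuclideanSpace ℝ (Fin m) → ℝ) (C : ℝ) (hC0 : 0 ≤ C)
    (hC : ∀ u, ‖u‖ ≤ C * N u) (v u : EuclideanSpace ℝ (Fin m)) (hu : N u ≤ 1) :
    inner ℝ v u ≤ ‖v‖ * C := by
  refine (real_inner_le_norm v u).trans ?_
  gcongr
  exact (hC u).trans (by nlinarith)

/-- **Sphere test for norm regularizers.** Suppose `Ω_g = N` is a norm with dual
norm `N°`, `X_g^⊤ θ̂ ∈ ∂N(β̂_g)` and `θ̂ ∈ B(c,r)`. If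
`N°(X_g^⊤ c) + r · sup_{‖u‖ ≤ 1} N°(X_g^⊤ u) < 1`, then `β̂_g = 0`. -/
theorem sphere_test_norm_regularizer (n m : ℕ)
    (Xg : Matrix (Fin n) (Fin m) ℝ)
    (N : EuclideanSpace ℝ (Fin m) → ℝ)
    (hN_add : ∀ x y, N (x + y) ≤ N x + N y)
    (hN_smul : ∀ (a : ℝ) x, N (a • x) = |a| * N x)
    (hN_pos : ∀ x, N x = 0 → x = 0)
    (βhat_g : EuclideanSpace ℝ (Fin m)) (θhat : EuclideanSpace ℝ (Fin n))
    (hopt : mvT Xg θhat ∈ subdiff (fun x => ((N x : ℝ) : EReal)) βhat_g)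
    (c : EuclideanSpace ℝ (Fin n)) (r : ℝ) (hr : 0 ≤ r)
    (hball : θhat ∈ Metric.closedBall c r)
    (htest : dualNorm N (mvT Xg c)
        + r * sSup ((fun u : EuclideanSpace ℝ (Fin n) => dualNorm N (mvT Xg u)) ''
            Metric.closedBall 0 1) < 1) :
    βhat_g = 0 := by
  obtain ⟨C, hC0, hC⟩ := norm_equiv_aux N hN_add hN_smul hN_pos
  have h0 : N 0 = 0 := by simpa using hN_smul 0 0
  have hle : ∀ v u, N u ≤ 1 → inner ℝ v u ≤ dualNorm N v := by
    intro v u hu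
    refine le_csSup ⟨‖v‖ * C, ?_⟩ ⟨u, hu, rfl⟩
    rintro _ ⟨u, hu, rfl⟩
    exact dual_bound_aux N C hC0 hC v u hu
  have hdn : ∀ v, dualNorm N v ≤ ‖v‖ * C := by
    intro v
    refine csSup_le ⟨_, 0, by simp [h0], rfl⟩ ?_
    rintro _ ⟨u, hu, rfl⟩
    exact dual_bound_aux N C hC0 hC v u hu
  have hcont : Continuous (fun w : EuclideanSpace ℝ (Fin n) => ‖mvT Xg w‖ * C) := by
    unfold mvT
    fun_prop
  obtain ⟨M, hM⟩ := (isCompact_closedBall (0 : EuclideanSpace ℝ (Fin n)) 1).bddAbove_image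
    hcont.continuousOn
  have hS : ∀ w ∈ Metric.closedBall (0 : EuclideanSpace ℝ (Fin n)) 1, dualNorm N (mvT Xg w) ≤
      sSup ((fun u : EuclideanSpace ℝ (Fin n) => dualNorm N (mvT Xg u)) ''
            Metric.closedBall 0 1) := by
    intro w hw
    refine le_csSup ⟨M, ?_⟩ ⟨w, hw, rfl⟩
    rintro _ ⟨w, hw, rfl⟩
    exact (hdn _).trans (hM ⟨w, hw, rfl⟩)
  have hb : N βhat_g ≤ inner ℝ (mvT Xg θhat) βhat_g := by
    have h := hopt 0
    simp only [h0] at h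
    have h : N βhat_g + inner ℝ (mvT Xg θhat) (0 - βhat_g) ≤ 0 := by exact_mod_cast h
    rw [zero_sub, inner_neg_right] at h
    linarith
  by_contra hne
  have hpos : 0 < N βhat_g := by
    have h1 := hC βhat_g
    have h2 : 0 < ‖βhat_g‖ := norm_pos_iff.2 hne
    by_contra h3
    nlinarith
  set u := (N βhat_g)⁻¹ • βhat_g with hu
  have hNu : N u ≤ 1 := by
    rw [hu, hN_smul, abs_of_pos (by positivity), inv_mul_cancel₀ hpos.ne']
  have h1 : 1 ≤ inner ℝ (mvT Xg θhat) u := by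
    rw [hu, inner_smul_right, inv_mul_eq_div, le_div_iff₀ hpos]
    linarith
  have hn : ‖θhat - c‖ ≤ r := by rwa [Metric.mem_closedBall, dist_eq_norm] at hball
  set w := r⁻¹ • (θhat - c) with hw
  have hwr : θhat = c + r • w := by
    rcases hr.eq_or_lt with h | h
    · have : θhat - c = 0 := by
        rw [← norm_le_zero_iff]; linarith
      rw [hw, this]; simp [sub_eq_zero.1 this]
    · rw [hw, smul_smul, mul_inv_cancel₀ h.ne']; simp
  have hwb : w ∈ Metric.closedBall (0 : EuclideanSpace ℝ (Fin n)) 1 := by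
    rw [mem_closedBall_zero_iff, hw, norm_smul, norm_inv, Real.norm_of_nonneg hr, inv_mul_eq_div]
    exact div_le_one_of_le₀ hn hr
  have hlin : mvT Xg θhat = mvT Xg c + r • mvT Xg w := by
    conv_lhs => rw [hwr]
    ext j
    simp only [mvT, PiLp.add_apply, PiLp.smul_apply, smul_eq_mul, Finset.mul_sum,
      ← Finset.sum_add_distrib]
    exact Finset.sum_congr rfl fun i _ => by ring
  rw [hlin, inner_add_left, real_inner_smul_left] at h1
  have h2 := hle (mvT Xg c) u hNu
  have h3 := mul_le_mul_of_nonneg_left ((hle (mvT Xg w) u hNu).trans (hS w hwb)) hr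
  linarith
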